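/- arXiv:math/0201060 — 2 statements merged into one kernel-verified Lean document; each statement's English description precedes it below -/
import Mathlib

section
/- There exist absolute constants c, C > 0 such that for every finite collection 𝐏 of quartiles, every j ∈ {1,2,3}, and every sequence of complex numbers (a_{P_j})_{P∈𝐏}, one has c · S ≤ size_j((a_{P_j})_{P∈𝐏}) ≤ C · S, where S := sup over all trees T ⊆ 𝐏 which are i-trees for some i ≠ j of |I_T|^{−1} ‖(Σ_{P∈T} |a_{P_j}|² χ_{I_P}/|I_P|)^{1/2}‖_{L^{1,∞}(I_T)}, and ‖g‖_{L^{1,∞}(I)} := sup_{λ>0} λ·|{x ∈ I : |g(x)| > λ}|. -/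
open MeasureTheory Set
open scoped ENNReal NNReal Classical

noncomputable section

/-- The `l`-th Walsh function. -/
def walsh : ℕ → ℝ → ℝ
  | 0, x => if 0 ≤ x ∧ x < 1 then 1 else 0
  | (n+1), x =>
    if (n+1) % 2 = 0 then walsh ((n+1)/2) (2*x) + walsh ((n+1)/2) (2*x - 1)
    else walsh ((n+1)/2) (2*x) - walsh ((n+1)/2) (2*x - 1)
  decreasing_by all_goals exact Nat.div_lt_self (Nat.succ_pos n) one_lt_two

/-- A tile `[2^{-k}n, 2^{-k}(n+1)) × [2^k l, 2^k(l+1))`. -/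
structure Tile where
  k : ℤ
  n : ℤ
  l : ℕ

namespace Tile

/-- The time interval `I_P`. -/
def spat (P : Tile) : Set ℝ := Ico ((2:ℝ)^(-P.k) * P.n) ((2:ℝ)^(-P.k) * (P.n + 1))

/-- The frequency interval `ω_P`. -/
def freq (P : Tile) : Set ℝ := Ico ((2:ℝ)^P.k * P.l) ((2:ℝ)^P.k * (P.l + 1))

/-- The tile as a subset of the phase plane. -/
def carrier (P : Tile) : Set (ℝ × ℝ) := P.spat ×ˢ P.freq

/-- The Walsh wave packet `φ_P`. -/
def wp (P : Tile) : ℝ → ℝ := fun x => (2:ℝ) ^ ((P.k : ℝ)/2) * walsh P.l ((2:ℝ)^P.k * x - P.n)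

/-- `P' < P` iff `I_{P'} ⊊ I_P` and `ω_P ⊆ ω_{P'}`. -/
def lt (P' P : Tile) : Prop := P'.spat ⊂ P.spat ∧ P.freq ⊆ P'.freq

/-- `P' ≤ P` iff `P' < P` or `P' = P`. -/
def le (P' P : Tile) : Prop := Tile.lt P' P ∨ P' = P

end Tile

/-- A quartile `[2^{-k}n, 2^{-k}(n+1)) × [2^{k+2} l, 2^{k+2}(l+1))`. -/
structure Quartile where
  k : ℤ
  n : ℤ
  l : ℕ

namespace Quartile

/-- The time interval `I_Q`. -/
def spat (Q : Quartile) : Set ℝ := Ico ((2:ℝ)^(-Q.k) * Q.n) ((2:ℝ)^(-Q.k) * (Q.n + 1))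

/-- The frequency interval `ω_Q`. -/
def freq (Q : Quartile) : Set ℝ := Ico ((2:ℝ)^(Q.k+2) * Q.l) ((2:ℝ)^(Q.k+2) * (Q.l + 1))

/-- The length `|I_Q| = 2^{-k}`. -/
def len (Q : Quartile) : ℝ := (2:ℝ)^(-Q.k)

/-- The sub-tiles `Q₁, Q₂, Q₃` (for `j = 1, 2, 3`). -/
def st (Q : Quartile) (j : ℕ) : Tile := ⟨Q.k, Q.n, 4 * Q.l + (j - 1)⟩

/-- The sub-bitile `Q₁₂ = Q₁ ∪ Q₂`, as a subset of the phase plane. -/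
def bicarrier (Q : Quartile) : Set (ℝ × ℝ) := Q.spat ×ˢ ((Q.st 1).freq ∪ (Q.st 2).freq)

/-- The order `<` on (sub-bi)tiles: `Q₁₂ < Q'₁₂`. -/
def biLt (Q Q' : Quartile) : Prop :=
  Q.spat ⊂ Q'.spat ∧ ((Q'.st 1).freq ∪ (Q'.st 2).freq) ⊆ ((Q.st 1).freq ∪ (Q.st 2).freq)

/-- The order `<` on quartiles. -/
def qlt (Q Q' : Quartile) : Prop := Q.spat ⊂ Q'.spat ∧ Q'.freq ⊆ Q.freq

end Quartile

/-- An `i`-tree `T` with top `Ptop`. -/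
def IsTree (i : ℕ) (Ptop : Quartile) (T : Finset Quartile) : Prop :=
  ∀ P ∈ T, Tile.le (P.st i) (Ptop.st i)

/-- The inner product `⟨f, φ_P⟩`. -/
def winner (f : ℝ → ℝ) (P : Tile) : ℝ := ∫ x, f x * P.wp x

/-- Indicator of a proposition. -/
def ind (p : Prop) : ℝ := if p then 1 else 0

/-- `size_j` of a sequence of numbers indexed by quartiles. -/
def size (PP : Finset Quartile) (j : ℕ) (a : Quartile → ℝ) : ℝ :=
  sSup {s | ∃ i ∈ ({1,2,3} : Set ℕ), i ≠ j ∧ ∃ Ptop : Quartile, ∃ T : Finset Quartile,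
    T ⊆ PP ∧ IsTree i Ptop T ∧
    s = Real.sqrt ((Ptop.len)⁻¹ * ∑ P ∈ T, |a P| ^ 2)}

/-- `energy_j` of a sequence of numbers indexed by quartiles. -/
def energy (PP : Finset Quartile) (j : ℕ) (a : Quartile → ℝ) : ℝ :=
  sSup {s | ∃ D : Finset Quartile, D ⊆ PP ∧
    (∀ P ∈ D, ∀ P' ∈ D, P ≠ P' → Disjoint ((P.st j).carrier) ((P'.st j).carrier)) ∧
    s = Real.sqrt (∑ P ∈ D, |a P| ^ 2)}


/-- `size_j` of a sequence of complex numbers indexed by quartiles. -/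
def sizeC (PP : Finset Quartile) (j : ℕ) (a : Quartile → ℂ) : ℝ :=
  sSup {s | ∃ i ∈ ({1,2,3} : Set ℕ), i ≠ j ∧ ∃ Ptop : Quartile, ∃ T : Finset Quartile,
    T ⊆ PP ∧ IsTree i Ptop T ∧
    s = Real.sqrt ((Ptop.len)⁻¹ * ∑ P ∈ T, ‖a P‖ ^ 2)}

/-- The square function `(Σ_{P∈T} |a_P|² χ_{I_P}/|I_P|)^{1/2}` associated to a tree. -/
def treeSqFn (T : Finset Quartile) (a : Quartile → ℂ) : ℝ → ℝ := fun x =>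
  Real.sqrt (∑ P ∈ T, ‖a P‖ ^ 2 * Set.indicator P.spat (fun _ => (P.len)⁻¹) x)

/-- The weak `L^{1,∞}` quasinorm of `g` on a set `I`. -/
def wkNorm (g : ℝ → ℝ) (I : Set ℝ) : ℝ :=
  sSup {t | ∃ lam : ℝ, 0 < lam ∧ t = lam * (volume (I ∩ {x | lam < |g x|})).toReal}

/-- The `L^{1,∞}`-based variant of the size. -/
def sizeWk (PP : Finset Quartile) (j : ℕ) (a : Quartile → ℂ) : ℝ :=
  sSup {s | ∃ i ∈ ({1,2,3} : Set ℕ), i ≠ j ∧ ∃ Ptop : Quartile, ∃ T : Finset Quartile,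
    T ⊆ PP ∧ IsTree i Ptop T ∧
    s = (Ptop.len)⁻¹ * wkNorm (treeSqFn T a) Ptop.spat}

section Dyadic

/-- The dyadic interval `[2^a m, 2^a (m+1))`. -/
def dyadicIco (a m : ℤ) : Set ℝ := Ico ((2:ℝ)^a * m) ((2:ℝ)^a * (m + 1))

theorem dyadicIco_subset_of_mem {a b m n : ℤ} (hab : a ≤ b) {x : ℝ}
    (hx : x ∈ dyadicIco a m) (hx' : x ∈ dyadicIco b n) : dyadicIco a m ⊆ dyadicIco b n := by
  obtain ⟨d, rfl⟩ := Int.le.dest hab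
  have ha : (0:ℝ) < (2:ℝ)^a := by positivity
  have hb : (2:ℝ)^(a + (d:ℤ)) = (2:ℝ)^a * ((2^d : ℤ) : ℝ) := by
    rw [zpow_add₀ two_ne_zero]; push_cast; simp
  unfold dyadicIco at hx hx' ⊢
  rw [hb, mul_assoc, mul_assoc] at hx' ⊢
  have h1 : (((2^d : ℤ) * n : ℤ) : ℝ) < ((m + 1 : ℤ) : ℝ) := by
    have := lt_of_mul_lt_mul_left (hx'.1.trans_lt hx.2) ha.le
    push_cast at this ⊢; exact this
  have h2 : ((m : ℤ) : ℝ) < (((2^d : ℤ) * (n + 1) : ℤ) : ℝ) := by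
    have := lt_of_mul_lt_mul_left (hx.1.trans_lt hx'.2) ha.le
    push_cast at this ⊢; exact this
  have h1' : (((2^d : ℤ) * n : ℤ) : ℝ) ≤ (m : ℝ) := by
    exact_mod_cast Int.lt_add_one_iff.mp (Int.cast_lt.mp h1)
  have h2' : ((m + 1 : ℤ) : ℝ) ≤ (((2^d : ℤ) * (n + 1) : ℤ) : ℝ) := by
    exact_mod_cast Int.add_one_le_iff.mpr (Int.cast_lt.mp h2)
  push_cast at h1' h2'
  apply Ico_subset_Ico
  · push_cast; exact mul_le_mul_of_nonneg_left h1' ha.le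
  · push_cast; exact mul_le_mul_of_nonneg_left h2' ha.le

theorem dyadicIco_left_mem (a m : ℤ) : (2:ℝ)^a * m ∈ dyadicIco a m := by
  have ha : (0:ℝ) < (2:ℝ)^a := by positivity
  exact ⟨le_rfl, by nlinarith⟩

theorem dyadicIco_index_eq {a m n : ℤ} {x : ℝ}
    (hx : x ∈ dyadicIco a m) (hx' : x ∈ dyadicIco a n) : m = n := by
  have ha : (0:ℝ) < (2:ℝ)^a := by positivity
  have h1 : (m : ℝ) < n + 1 := lt_of_mul_lt_mul_left (hx.1.trans_lt hx'.2) ha.le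
  have h2 : (n : ℝ) < m + 1 := lt_of_mul_lt_mul_left (hx'.1.trans_lt hx.2) ha.le
  have h1' : m < n + 1 := by exact_mod_cast h1
  have h2' : n < m + 1 := by exact_mod_cast h2
  omega

theorem dyadicIco_le_of_subset {a b m n : ℤ} (h : dyadicIco a m ⊆ dyadicIco b n) : a ≤ b := by
  have ha : (0:ℝ) < (2:ℝ)^a := by positivity
  have h' := (Ico_subset_Ico_iff (by nlinarith)).1 h
  have : (2:ℝ)^a ≤ (2:ℝ)^b := by nlinarith [h'.1, h'.2]
  exact (zpow_le_zpow_iff_right₀ one_lt_two).1 this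

theorem Quartile.spat_eq_dyadicIco (Q : Quartile) : Q.spat = dyadicIco (-Q.k) Q.n := rfl

theorem Tile.freq_eq_dyadicIco (P : Tile) : P.freq = dyadicIco P.k P.l := by
  simp [Tile.freq, dyadicIco]

end Dyadic

namespace Quartile

theorem len_pos (Q : Quartile) : 0 < Q.len := by unfold len; positivity

theorem measurableSet_spat (Q : Quartile) : MeasurableSet Q.spat := measurableSet_Ico

theorem volume_spat (Q : Quartile) : volume Q.spat = ENNReal.ofReal Q.len := by
  rw [spat, Real.volume_Ico, len]; congr 1; ring

theorem volume_real_spat (Q : Quartile) : volume.real Q.spat = Q.len := by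
  rw [Measure.real, volume_spat, ENNReal.toReal_ofReal Q.len_pos.le]

theorem len_le_of_spat_subset {P Q : Quartile} (h : P.spat ⊆ Q.spat) : P.len ≤ Q.len :=
  zpow_le_zpow_right₀ one_le_two (dyadicIco_le_of_subset h)

theorem spat_subset_of_mem {P Q : Quartile} (hlen : P.len ≤ Q.len) {x : ℝ}
    (hP : x ∈ P.spat) (hQ : x ∈ Q.spat) : P.spat ⊆ Q.spat :=
  dyadicIco_subset_of_mem ((zpow_le_zpow_iff_right₀ one_lt_two).1 hlen) hP hQ

end Quartile

namespace IsTree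

variable {i : ℕ} {Ptop : Quartile} {T : Finset Quartile}

theorem spat_subset (hT : IsTree i Ptop T) {P : Quartile} (hP : P ∈ T) :
    P.spat ⊆ Ptop.spat := by
  rcases hT P hP with h | h
  · exact h.1.subset
  · exact (congrArg Tile.spat h).subset

theorem freq_subset (hT : IsTree i Ptop T) {P : Quartile} (hP : P ∈ T) :
    (Ptop.st i).freq ⊆ (P.st i).freq := by
  rcases hT P hP with h | h
  · exact h.2
  · rw [h]

theorem le_of_spat_subset (hT : IsTree i Ptop T) {P Q : Quartile} (hP : P ∈ T) (hQ : Q ∈ T)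
    (h : P.spat ⊆ Q.spat) : Tile.le (P.st i) (Q.st i) := by
  have hk : -P.k ≤ -Q.k := dyadicIco_le_of_subset h
  obtain ⟨y, hy⟩ : (Ptop.st i).freq.Nonempty :=
    ⟨_, by rw [Tile.freq_eq_dyadicIco]; exact dyadicIco_left_mem _ _⟩
  have hyP := hT.freq_subset hP hy
  have hyQ := hT.freq_subset hQ hy
  rw [Tile.freq_eq_dyadicIco] at hyP hyQ
  rcases hk.lt_or_eq with hlt | heq
  · refine Or.inl ⟨⟨h, fun h' => ?_⟩, ?_⟩
    · have : -Q.k ≤ -P.k := dyadicIco_le_of_subset h'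
      omega
    · rw [Tile.freq_eq_dyadicIco, Tile.freq_eq_dyadicIco]
      exact dyadicIco_subset_of_mem (by simp only [Quartile.st]; omega) hyQ hyP
  · right
    have hkk : P.k = Q.k := by omega
    have hx : (2:ℝ)^(-P.k) * P.n ∈ dyadicIco (-P.k) P.n := dyadicIco_left_mem _ _
    have hx' := h hx
    rw [Quartile.spat_eq_dyadicIco, ← hkk] at hx'
    have hn : P.n = Q.n := dyadicIco_index_eq hx hx'
    have hl : ((P.st i).l : ℤ) = (Q.st i).l := by
      have e : (Q.st i).k = (P.st i).k := hkk.symm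
      rw [e] at hyQ
      exact dyadicIco_index_eq hyP hyQ
    have hl' : (P.st i).l = (Q.st i).l := by exact_mod_cast hl
    simp only [Quartile.st] at hl' ⊢
    rw [hkk, hn, hl']

end IsTree

section SquareFunction

/-- The square `Σ_{P∈T} |a_P|² χ_{I_P}/|I_P|` of the square function of `T`. -/
def sqSum (T : Finset Quartile) (a : Quartile → ℂ) (x : ℝ) : ℝ :=
  ∑ P ∈ T, ‖a P‖ ^ 2 * Set.indicator P.spat (fun _ => (P.len)⁻¹) x

variable (T : Finset Quartile) (a : Quartile → ℂ)

theorem sqSum_nonneg (x : ℝ) : 0 ≤ sqSum T a x :=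
  Finset.sum_nonneg fun P _ =>
    mul_nonneg (sq_nonneg _) (indicator_nonneg (fun _ _ => (inv_pos.2 P.len_pos).le) x)

theorem integrable_indicator_spat (P : Quartile) (c : ℝ) :
    Integrable (P.spat.indicator fun _ => c) :=
  (integrable_indicator_iff P.measurableSet_spat).2
    (integrableOn_const (by rw [P.volume_spat]; exact ENNReal.ofReal_ne_top))

theorem integral_indicator_spat (P : Quartile) (c : ℝ) :
    ∫ x, P.spat.indicator (fun _ => c) x = P.len * c := by
  rw [integral_indicator_const _ P.measurableSet_spat, P.volume_real_spat, smul_eq_mul]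

theorem integrable_sqSum : Integrable (sqSum T a) :=
  integrable_finsetSum _ fun P _ => (integrable_indicator_spat P _).const_mul _

theorem integral_sqSum : ∫ x, sqSum T a x = ∑ P ∈ T, ‖a P‖ ^ 2 := by
  unfold sqSum
  rw [integral_finsetSum _ fun P _ => (integrable_indicator_spat P _).const_mul _]
  refine Finset.sum_congr rfl fun P _ => ?_
  rw [integral_const_mul, integral_indicator_spat, mul_inv_cancel₀ P.len_pos.ne', mul_one]

theorem lt_abs_treeSqFn_iff {lam : ℝ} (hlam : 0 < lam) (x : ℝ) :
    lam < |treeSqFn T a x| ↔ lam ^ 2 < sqSum T a x := by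
  rw [treeSqFn, abs_of_nonneg (Real.sqrt_nonneg _), Real.lt_sqrt hlam.le, sqSum]

theorem measurable_sqSum : Measurable (sqSum T a) :=
  Finset.measurable_fun_sum _ fun P _ =>
    (measurable_const.indicator P.measurableSet_spat).const_mul _

theorem measurableSet_superlevel (Q : Quartile) {lam : ℝ} (hlam : 0 < lam) :
    MeasurableSet (Q.spat ∩ {x | lam < |treeSqFn T a x|}) := by
  simp only [lt_abs_treeSqFn_iff T a hlam]
  exact Q.measurableSet_spat.inter (measurableSet_lt measurable_const (measurable_sqSum T a))

theorem volume_superlevel_ne_top (Q : Quartile) (S : Set ℝ) : volume (Q.spat ∩ S) ≠ ∞ :=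
  measure_ne_top_of_subset inter_subset_left
    (by rw [Q.volume_spat]; exact ENNReal.ofReal_ne_top)

theorem volume_superlevel_le_len (Q : Quartile) (S : Set ℝ) :
    (volume (Q.spat ∩ S)).toReal ≤ Q.len := by
  rw [← Q.volume_real_spat]
  exact ENNReal.toReal_mono (by rw [Q.volume_spat]; exact ENNReal.ofReal_ne_top)
    (measure_mono inter_subset_left)

theorem sq_mul_volume_superlevel_le (Q : Quartile) {lam : ℝ} (hlam : 0 < lam) :
    lam ^ 2 * (volume (Q.spat ∩ {x | lam < |treeSqFn T a x|})).toReal ≤ ∑ P ∈ T, ‖a P‖ ^ 2 := by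
  set E := Q.spat ∩ {x | lam < |treeSqFn T a x|}
  have hE : MeasurableSet E := measurableSet_superlevel T a Q hlam
  calc lam ^ 2 * (volume E).toReal = ∫ x, E.indicator (fun _ => lam ^ 2) x := by
        rw [integral_indicator_const _ hE, smul_eq_mul, mul_comm, Measure.real]
    _ ≤ ∫ x, sqSum T a x := by
        refine integral_mono ((integrable_indicator_iff hE).2 (integrableOn_const
          (volume_superlevel_ne_top Q _))) (integrable_sqSum T a) fun x => ?_
        by_cases hx : x ∈ E
        · simpa [hx] using ((lt_abs_treeSqFn_iff T a hlam x).1 hx.2).le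
        · simpa [hx] using sqSum_nonneg T a x
    _ = _ := integral_sqSum T a

theorem mul_volume_superlevel_le (Q : Quartile) {lam : ℝ} (hlam : 0 < lam) :
    lam * (volume (Q.spat ∩ {x | lam < |treeSqFn T a x|})).toReal
      ≤ Q.len * Real.sqrt (Q.len⁻¹ * ∑ P ∈ T, ‖a P‖ ^ 2) := by
  have h1 := sq_mul_volume_superlevel_le T a Q hlam
  have h2 := volume_superlevel_le_len Q {x | lam < |treeSqFn T a x|}
  set v := (volume (Q.spat ∩ {x | lam < |treeSqFn T a x|})).toReal
  have hv : 0 ≤ v := ENNReal.toReal_nonneg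
  have hL := Q.len_pos
  have h : Q.len⁻¹ * (lam * v) ≤ Real.sqrt (Q.len⁻¹ * ∑ P ∈ T, ‖a P‖ ^ 2) := by
    refine Real.le_sqrt_of_sq_le ?_
    calc (Q.len⁻¹ * (lam * v)) ^ 2 = Q.len⁻¹ * (lam ^ 2 * v) * (Q.len⁻¹ * v) := by ring
      _ ≤ Q.len⁻¹ * (lam ^ 2 * v) * 1 := by
          gcongr
          rw [inv_mul_le_iff₀ hL]; simpa using h2
      _ ≤ Q.len⁻¹ * ∑ P ∈ T, ‖a P‖ ^ 2 := by rw [mul_one]; gcongr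
  rwa [inv_mul_le_iff₀ hL] at h

theorem mul_volume_superlevel_le_wkNorm (Q : Quartile) {lam : ℝ} (hlam : 0 < lam) :
    lam * (volume (Q.spat ∩ {x | lam < |treeSqFn T a x|})).toReal
      ≤ wkNorm (treeSqFn T a) Q.spat :=
  le_csSup ⟨_, by rintro _ ⟨mu, hmu, rfl⟩; exact mul_volume_superlevel_le T a Q hmu⟩
    ⟨lam, hlam, rfl⟩

theorem len_inv_mul_wkNorm_le (Q : Quartile) :
    Q.len⁻¹ * wkNorm (treeSqFn T a) Q.spat ≤ Real.sqrt (Q.len⁻¹ * ∑ P ∈ T, ‖a P‖ ^ 2) := by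
  have hL := Q.len_pos
  rw [inv_mul_le_iff₀ hL]
  refine Real.sSup_le ?_ (by positivity)
  rintro _ ⟨mu, hmu, rfl⟩
  exact mul_volume_superlevel_le T a Q hmu

end SquareFunction

section Sizes

variable {PP : Finset Quartile} {j : ℕ} {a : Quartile → ℂ}

theorem bddAbove_sizeC_set (PP : Finset Quartile) (j : ℕ) (a : Quartile → ℂ) :
    BddAbove {s | ∃ i ∈ ({1,2,3} : Set ℕ), i ≠ j ∧ ∃ Ptop : Quartile, ∃ T : Finset Quartile,
      T ⊆ PP ∧ IsTree i Ptop T ∧ s = Real.sqrt ((Ptop.len)⁻¹ * ∑ P ∈ T, ‖a P‖ ^ 2)} := by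
  refine ⟨Real.sqrt (∑ P ∈ PP, P.len⁻¹ * ‖a P‖ ^ 2), ?_⟩
  rintro _ ⟨i, -, -, Ptop, T, hTP, hT, rfl⟩
  apply Real.sqrt_le_sqrt
  rw [Finset.mul_sum]
  calc ∑ P ∈ T, Ptop.len⁻¹ * ‖a P‖ ^ 2 ≤ ∑ P ∈ T, P.len⁻¹ * ‖a P‖ ^ 2 := by
        refine Finset.sum_le_sum fun P hP => mul_le_mul_of_nonneg_right ?_ (sq_nonneg _)
        exact inv_anti₀ P.len_pos (Quartile.len_le_of_spat_subset (hT.spat_subset hP))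
    _ ≤ _ := Finset.sum_le_sum_of_subset_of_nonneg hTP fun P _ _ =>
        mul_nonneg (inv_pos.2 P.len_pos).le (sq_nonneg _)

theorem sizeC_nonneg : 0 ≤ sizeC PP j a :=
  Real.sSup_nonneg (by rintro _ ⟨i, -, -, Ptop, T, -, -, rfl⟩; exact Real.sqrt_nonneg _)

theorem sqrt_le_sizeC {i : ℕ} (hi : i ∈ ({1,2,3} : Set ℕ)) (hij : i ≠ j) {Ptop : Quartile}
    {T : Finset Quartile} (hTP : T ⊆ PP) (hT : IsTree i Ptop T) :
    Real.sqrt ((Ptop.len)⁻¹ * ∑ P ∈ T, ‖a P‖ ^ 2) ≤ sizeC PP j a :=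
  le_csSup (bddAbove_sizeC_set PP j a) ⟨i, hi, hij, Ptop, T, hTP, hT, rfl⟩

theorem sum_le_sizeC_sq_mul_len {i : ℕ} (hi : i ∈ ({1,2,3} : Set ℕ)) (hij : i ≠ j)
    {Ptop : Quartile} {T : Finset Quartile} (hTP : T ⊆ PP) (hT : IsTree i Ptop T) :
    ∑ P ∈ T, ‖a P‖ ^ 2 ≤ sizeC PP j a ^ 2 * Ptop.len := by
  have h := (Real.sqrt_le_left sizeC_nonneg).1 (sqrt_le_sizeC (a := a) hi hij hTP hT)
  rw [inv_mul_le_iff₀ Ptop.len_pos] at h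
  linarith

theorem sizeWk_le_sizeC : sizeWk PP j a ≤ sizeC PP j a := by
  refine Real.sSup_le ?_ sizeC_nonneg
  rintro _ ⟨i, hi, hij, Ptop, T, hTP, hT, rfl⟩
  exact (len_inv_mul_wkNorm_le T a Ptop).trans (sqrt_le_sizeC hi hij hTP hT)

theorem mul_volume_superlevel_le_sizeWk {i : ℕ} (hi : i ∈ ({1,2,3} : Set ℕ)) (hij : i ≠ j)
    {Ptop : Quartile} {T : Finset Quartile} (hTP : T ⊆ PP) (hT : IsTree i Ptop T)
    {lam : ℝ} (hlam : 0 < lam) :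
    lam * (volume (Ptop.spat ∩ {x | lam < |treeSqFn T a x|})).toReal
      ≤ Ptop.len * sizeWk PP j a := by
  have h : Ptop.len⁻¹ * wkNorm (treeSqFn T a) Ptop.spat ≤ sizeWk PP j a := by
    refine le_csSup ⟨sizeC PP j a, ?_⟩ ⟨i, hi, hij, Ptop, T, hTP, hT, rfl⟩
    rintro _ ⟨i', hi', hij', Ptop', T', hTP', hT', rfl⟩
    exact (len_inv_mul_wkNorm_le T' a Ptop').trans (sqrt_le_sizeC hi' hij' hTP' hT')
  rw [inv_mul_le_iff₀ Ptop.len_pos] at h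
  exact (mul_volume_superlevel_le_wkNorm T a Ptop hlam).trans h

theorem sizeWk_nonneg : 0 ≤ sizeWk PP j a := by
  refine Real.sSup_nonneg ?_
  rintro _ ⟨i, -, -, Ptop, T, -, -, rfl⟩
  refine mul_nonneg (inv_pos.2 Ptop.len_pos).le (Real.sSup_nonneg ?_)
  rintro _ ⟨lam, hlam, rfl⟩
  exact mul_nonneg hlam.le ENNReal.toReal_nonneg

end Sizes

section StoppingTime

/-- The sum of `|a_Q|²/|I_Q|` over the quartiles of `T` lying above `I_P`. -/
def ancestorSum (T : Finset Quartile) (a : Quartile → ℂ) (P : Quartile) : ℝ :=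
  ∑ Q ∈ T with P.spat ⊆ Q.spat, ‖a Q‖ ^ 2 * Q.len⁻¹

theorem ancestorSum_anti (T : Finset Quartile) (a : Quartile → ℂ) {P Q : Quartile}
    (h : P.spat ⊆ Q.spat) : ancestorSum T a Q ≤ ancestorSum T a P := by
  refine Finset.sum_le_sum_of_subset_of_nonneg (fun R hR => ?_) fun R _ _ =>
    mul_nonneg (sq_nonneg _) (inv_pos.2 R.len_pos).le
  rw [Finset.mem_filter] at hR ⊢
  exact ⟨hR.1, h.trans hR.2⟩

theorem sqSum_eq_sum_filter (T : Finset Quartile) (a : Quartile → ℂ) (x : ℝ) :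
    sqSum T a x = ∑ P ∈ T with x ∈ P.spat, ‖a P‖ ^ 2 * P.len⁻¹ := by
  rw [sqSum, Finset.sum_filter]
  refine Finset.sum_congr rfl fun P _ => ?_
  by_cases hx : x ∈ P.spat <;> simp [hx]

theorem ancestorSum_le_sqSum (T : Finset Quartile) (a : Quartile → ℂ) {P : Quartile} {x : ℝ}
    (hx : x ∈ P.spat) : ancestorSum T a P ≤ sqSum T a x := by
  rw [sqSum_eq_sum_filter]
  refine Finset.sum_le_sum_of_subset_of_nonneg (fun R hR => ?_) fun R _ _ =>
    mul_nonneg (sq_nonneg _) (inv_pos.2 R.len_pos).le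
  rw [Finset.mem_filter] at hR ⊢
  exact ⟨hR.1, hR.2 hx⟩

theorem sqSum_le_of_ancestorSum_le {T G : Finset Quartile} {a : Quartile → ℂ} {M : ℝ}
    (hM : 0 ≤ M) (hGT : G ⊆ T) (hG : ∀ P ∈ G, ancestorSum T a P ≤ M) (x : ℝ) :
    sqSum G a x ≤ M := by
  rw [sqSum_eq_sum_filter]
  rcases (G.filter (x ∈ ·.spat)).eq_empty_or_nonempty with h | h
  · simpa [h] using hM
  · obtain ⟨P, hP, hmin⟩ := Finset.exists_min_image _ Quartile.len h
    rw [Finset.mem_filter] at hP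
    refine le_trans (Finset.sum_le_sum_of_subset_of_nonneg (fun R hR => ?_) fun R _ _ =>
      mul_nonneg (sq_nonneg _) (inv_pos.2 R.len_pos).le) (hG P hP.1)
    have hlen := hmin R hR
    rw [Finset.mem_filter] at hR ⊢
    exact ⟨hGT hR.1, Quartile.spat_subset_of_mem hlen hP.2 hR.2⟩

/-- A pointwise bound on the square function bounds the sum of the squared coefficients. -/
theorem sum_sq_le_of_sqSum_le {G : Finset Quartile} {a : Quartile → ℂ} {M : ℝ}
    {Q : Quartile} (hQ : ∀ P ∈ G, P.spat ⊆ Q.spat) (h : ∀ x, sqSum G a x ≤ M) :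
    ∑ P ∈ G, ‖a P‖ ^ 2 ≤ Q.len * M := by
  rw [← integral_sqSum, ← integral_indicator_spat]
  refine integral_mono (integrable_sqSum G a) (integrable_indicator_spat Q M) fun x => ?_
  by_cases hx : x ∈ Q.spat
  · simpa [hx] using h x
  · have : sqSum G a x = 0 := Finset.sum_eq_zero fun P hP => by
      simp [show x ∉ P.spat from fun h' => hx (hQ P hP h')]
    simp [hx, this]

/-- The quartiles of `B` whose time interval is maximal. -/
def maximalQuartiles (B : Finset Quartile) : Finset Quartile :=
  B.filter fun P => ∀ Q ∈ B, P.spat ⊆ Q.spat → Q.spat ⊆ P.spat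

theorem exists_maximalQuartiles_superset {B : Finset Quartile} {P : Quartile} (hP : P ∈ B) :
    ∃ Q ∈ maximalQuartiles B, P.spat ⊆ Q.spat := by
  have hne : (B.filter (P.spat ⊆ ·.spat)).Nonempty :=
    ⟨P, Finset.mem_filter.2 ⟨hP, Subset.rfl⟩⟩
  obtain ⟨Q, hQ, hmax⟩ := Finset.exists_max_image _ Quartile.len hne
  rw [Finset.mem_filter] at hQ
  refine ⟨Q, Finset.mem_filter.2 ⟨hQ.1, fun R hR hQR => ?_⟩, hQ.2⟩
  have hx : (2:ℝ)^(-Q.k) * Q.n ∈ Q.spat := dyadicIco_left_mem _ _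
  exact Quartile.spat_subset_of_mem
    (hmax R (Finset.mem_filter.2 ⟨hR, hQ.2.trans hQR⟩)) (hQR hx) hx

theorem IsTree.eq_of_spat_eq {i : ℕ} {Ptop : Quartile} {T : Finset Quartile}
    (hT : IsTree i Ptop T) {P Q : Quartile} (hP : P ∈ T) (hQ : Q ∈ T) (h : P.spat = Q.spat) :
    P = Q := by
  rcases hT.le_of_spat_subset hP hQ h.subset with h' | h'
  · exact absurd h h'.1.ne
  · cases P; cases Q
    simp only [Quartile.st, Tile.mk.injEq, Quartile.mk.injEq] at h' ⊢
    omega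

theorem IsTree.pairwiseDisjoint_maximalQuartiles {i : ℕ} {Ptop : Quartile}
    {T B : Finset Quartile} (hT : IsTree i Ptop T) (hBT : B ⊆ T) :
    (maximalQuartiles B : Set Quartile).PairwiseDisjoint Quartile.spat := by
  intro P hP Q hQ hne
  rw [Finset.mem_coe, maximalQuartiles, Finset.mem_filter] at hP hQ
  rw [Function.onFun, Set.disjoint_left]
  intro x hxP hxQ
  refine hne (hT.eq_of_spat_eq (hBT hP.1) (hBT hQ.1) ?_)
  rcases le_total P.len Q.len with h | h
  · have h' := Quartile.spat_subset_of_mem h hxP hxQ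
    exact h'.antisymm (hP.2 Q hQ.1 h')
  · have h' := Quartile.spat_subset_of_mem h hxQ hxP
    exact (hQ.2 P hP.1 h').antisymm h'

theorem IsTree.sum_len_maximalQuartiles_le {i : ℕ} {Ptop : Quartile} {T B : Finset Quartile}
    {a : Quartile → ℂ} (hT : IsTree i Ptop T) (hBT : B ⊆ T) {lam : ℝ} (hlam : 0 < lam)
    (hB : ∀ P ∈ B, lam ^ 2 < ancestorSum T a P) :
    ∑ P ∈ maximalQuartiles B, P.len
      ≤ (volume (Ptop.spat ∩ {x | lam < |treeSqFn T a x|})).toReal := by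
  have hsub : (⋃ P ∈ maximalQuartiles B, P.spat) ⊆
      Ptop.spat ∩ {x | lam < |treeSqFn T a x|} := by
    refine iUnion₂_subset fun P hP x hx => ?_
    have hPB : P ∈ B := (Finset.mem_filter.1 hP).1
    exact ⟨hT.spat_subset (hBT hPB) hx, (lt_abs_treeSqFn_iff T a hlam x).2
      ((hB P hPB).trans_le (ancestorSum_le_sqSum T a hx))⟩
  have h := ENNReal.toReal_mono (volume_superlevel_ne_top Ptop _) (measure_mono hsub)
  rw [measure_biUnion_finset (hT.pairwiseDisjoint_maximalQuartiles hBT)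
    fun P _ => P.measurableSet_spat] at h
  rw [ENNReal.toReal_sum fun P _ => by rw [P.volume_spat]; exact ENNReal.ofReal_ne_top] at h
  simpa only [Quartile.volume_spat, ENNReal.toReal_ofReal (Quartile.len_pos _).le] using h

theorem IsTree.filter_spat_subset {i : ℕ} {Ptop : Quartile} {T : Finset Quartile}
    (hT : IsTree i Ptop T) {P : Quartile} (hP : P ∈ T) :
    IsTree i P (T.filter (·.spat ⊆ P.spat)) := fun _ hQ =>
  hT.le_of_spat_subset (Finset.mem_filter.1 hQ).1 hP (Finset.mem_filter.1 hQ).2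

/-- One step of the John–Nirenberg stopping time argument. -/
theorem IsTree.sum_sq_le {PP : Finset Quartile} {i j : ℕ} {a : Quartile → ℂ}
    (hi : i ∈ ({1,2,3} : Set ℕ)) (hij : i ≠ j) {Ptop : Quartile} {T : Finset Quartile}
    (hTP : T ⊆ PP) (hT : IsTree i Ptop T) {lam : ℝ} (hlam : 0 < lam) :
    ∑ P ∈ T, ‖a P‖ ^ 2 ≤ Ptop.len * lam ^ 2 + sizeC PP j a ^ 2 *
      (volume (Ptop.spat ∩ {x | lam < |treeSqFn T a x|})).toReal := by
  set B := T.filter fun P => lam ^ 2 < ancestorSum T a P with hB_def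
  have hBT : B ⊆ T := Finset.filter_subset _ _
  have hgood : ∑ P ∈ T with ¬ lam ^ 2 < ancestorSum T a P, ‖a P‖ ^ 2 ≤ Ptop.len * lam ^ 2 := by
    refine sum_sq_le_of_sqSum_le
      (fun P hP => hT.spat_subset (Finset.mem_filter.1 hP).1) fun x => ?_
    exact sqSum_le_of_ancestorSum_le (sq_nonneg _) (Finset.filter_subset _ T)
      (fun P hP => not_lt.1 (Finset.mem_filter.1 hP).2) x
  have hbad : ∑ P ∈ B, ‖a P‖ ^ 2 ≤ sizeC PP j a ^ 2 *
      (volume (Ptop.spat ∩ {x | lam < |treeSqFn T a x|})).toReal := by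
    calc ∑ P ∈ B, ‖a P‖ ^ 2
        ≤ ∑ P ∈ T, ∑ Q ∈ maximalQuartiles B with P.spat ⊆ Q.spat, ‖a P‖ ^ 2 := by
          refine (Finset.sum_le_sum fun P hP => ?_).trans
            (Finset.sum_le_sum_of_subset_of_nonneg hBT fun P _ _ =>
              Finset.sum_nonneg fun _ _ => sq_nonneg _)
          obtain ⟨Q, hQ, hPQ⟩ := exists_maximalQuartiles_superset hP
          exact Finset.single_le_sum (f := fun _ => ‖a P‖ ^ 2) (fun _ _ => sq_nonneg _)
            (Finset.mem_filter.2 ⟨hQ, hPQ⟩)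
      _ = ∑ Q ∈ maximalQuartiles B, ∑ P ∈ T with P.spat ⊆ Q.spat, ‖a P‖ ^ 2 := by
          simp only [Finset.sum_filter]
          exact Finset.sum_comm
      _ ≤ ∑ Q ∈ maximalQuartiles B, sizeC PP j a ^ 2 * Q.len := by
          refine Finset.sum_le_sum fun _ hQ => ?_
          exact sum_le_sizeC_sq_mul_len hi hij ((Finset.filter_subset _ T).trans hTP)
            (hT.filter_spat_subset (hBT (Finset.mem_filter.1 hQ).1))
      _ ≤ _ := by
          rw [← Finset.mul_sum]
          exact mul_le_mul_of_nonneg_left (hT.sum_len_maximalQuartiles_le hBT hlam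
            fun P hP => (Finset.mem_filter.1 hP).2) (sq_nonneg _)
  rw [← Finset.sum_filter_add_sum_filter_not T fun P => lam ^ 2 < ancestorSum T a P]
  linarith

theorem sizeC_le_of_sizeWk_lt {PP : Finset Quartile} {j : ℕ} {a : Quartile → ℂ} {A : ℝ}
    (hA : sizeWk PP j a < A) : sizeC PP j a ≤ 5 * A := by
  have hA0 : 0 < A := sizeWk_nonneg.trans_lt hA
  have hlam : 0 < 4 * A := by positivity
  set B := sizeC PP j a with hB_def
  have hB : 0 ≤ B := sizeC_nonneg
  have key : B ≤ Real.sqrt (16 * A ^ 2 + B ^ 2 / 4) := by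
    refine Real.sSup_le ?_ (Real.sqrt_nonneg _)
    rintro _ ⟨i, hi, hij, Ptop, T, hTP, hT, rfl⟩
    apply Real.sqrt_le_sqrt
    have h1 := hT.sum_sq_le (a := a) hi hij hTP hlam
    have h2 := mul_volume_superlevel_le_sizeWk (a := a) hi hij hTP hT hlam
    set v := (volume (Ptop.spat ∩ {x | 4 * A < |treeSqFn T a x|})).toReal
    have hL := Ptop.len_pos
    have hv : v ≤ Ptop.len / 4 := by
      have : 4 * A * v ≤ Ptop.len * A := h2.trans (mul_le_mul_of_nonneg_left hA.le hL.le)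
      refine le_of_mul_le_mul_left ?_ hlam
      linarith
    rw [inv_mul_le_iff₀ hL]
    have := mul_le_mul_of_nonneg_left hv (sq_nonneg B)
    rw [← hB_def] at h1
    linarith
  rw [Real.le_sqrt hB (by positivity)] at key
  nlinarith

end StoppingTime

/-- John–Nirenberg for sizes: the `L²`-based size and the `L^{1,∞}`-based size are
comparable, with absolute constants. -/
theorem size_johnNirenberg :
    ∃ c C : ℝ, 0 < c ∧ 0 < C ∧
      ∀ (PP : Finset Quartile) (j : ℕ), j ∈ ({1,2,3} : Set ℕ) →
        ∀ a : Quartile → ℂ,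
          c * sizeWk PP j a ≤ sizeC PP j a ∧ sizeC PP j a ≤ C * sizeWk PP j a := by
  refine ⟨1, 5, one_pos, by norm_num, fun PP j _ a => ⟨?_, ?_⟩⟩
  · rw [one_mul]
    exact sizeWk_le_sizeC
  · rw [mul_comm, ← div_le_iff₀ (by norm_num)]
    refine le_of_forall_gt_imp_ge_of_dense fun A hA => ?_
    rw [div_le_iff₀ (by norm_num), mul_comm]
    exact sizeC_le_of_sizeWk_lt hA

end
end

section
/- There is an absolute constant C such that for every j ∈ {1,2,3}, every measurable set E_j ⊂ ℝ of finite measure, every f_j ∈ X(E_j), and every finite collection 𝐏 of quartiles, one has size_j((⟨f_j, φ_{P_j}⟩)_{P∈𝐏}) ≤ C · sup_{P∈𝐏} |E_j ∩ I_P| / |I_P|. -/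
open MeasureTheory Set
open scoped ENNReal NNReal Classical

noncomputable section

theorem walsh_two_mul (l : ℕ) (x : ℝ) :
    walsh (2 * l) x = walsh l (2 * x) + walsh l (2 * x - 1) := by
  rcases l with _ | l
  · simp only [mul_zero, walsh]
    split_ifs <;> grind
  · have h : 2 * (l + 1) = (2 * l + 1) + 1 := by ring
    have h1 : (2 * l + 1 + 1) % 2 = 0 := by omega
    have h2 : (2 * l + 1 + 1) / 2 = l + 1 := by omega
    rw [h, walsh, if_pos h1, h2]

theorem walsh_two_mul_add_one (l : ℕ) (x : ℝ) :
    walsh (2 * l + 1) x = walsh l (2 * x) - walsh l (2 * x - 1) := by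
  have h1 : ¬ (2 * l + 1) % 2 = 0 := by omega
  have h2 : (2 * l + 1) / 2 = l := by omega
  rw [walsh, if_neg h1, h2]

theorem measurable_walsh (l : ℕ) : Measurable (walsh l) := by
  induction l using Nat.strong_induction_on with
  | _ l ih =>
    rcases Nat.eq_zero_or_pos l with rfl | hl
    · have : walsh 0 = fun x => if x ∈ Ico (0 : ℝ) 1 then (1 : ℝ) else 0 := by
        ext x; simp [walsh]
      rw [this]
      exact Measurable.ite measurableSet_Ico measurable_const measurable_const
    · have hm := ih (l / 2) (by omega)
      rcases Nat.even_or_odd' l with ⟨c, rfl | rfl⟩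
      · have hc : 2 * c / 2 = c := by omega
        rw [hc] at hm
        rw [funext (walsh_two_mul c)]
        fun_prop
      · have hc : (2 * c + 1) / 2 = c := by omega
        rw [hc] at hm
        rw [funext (walsh_two_mul_add_one c)]
        fun_prop

theorem walsh_zero_nonneg (x : ℝ) : 0 ≤ walsh 0 x := by
  rw [walsh]; split_ifs <;> norm_num

theorem abs_walsh_le (l : ℕ) (x : ℝ) : |walsh l x| ≤ walsh 0 x := by
  induction l using Nat.strong_induction_on generalizing x with
  | _ l ih =>
    rcases Nat.eq_zero_or_pos l with rfl | hl
    · rw [abs_of_nonneg (walsh_zero_nonneg x)]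
    · have h0 := walsh_two_mul 0 x
      rw [mul_zero] at h0
      rcases Nat.even_or_odd' l with ⟨c, rfl | rfl⟩
      · have ha := ih c (by omega) (2 * x)
        have hb := ih c (by omega) (2 * x - 1)
        rw [walsh_two_mul, h0]
        exact (abs_add_le _ _).trans (add_le_add ha hb)
      · have ha := ih c (by omega) (2 * x)
        have hb := ih c (by omega) (2 * x - 1)
        rw [walsh_two_mul_add_one, h0]
        exact (abs_sub _ _).trans (add_le_add ha hb)

theorem walsh_zero_le_one (x : ℝ) : walsh 0 x ≤ 1 := by
  rw [walsh]; split_ifs <;> norm_num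

/-- The Walsh coefficient of `f` without `L²` normalization. -/
def walshCoeff (f : ℝ → ℝ) (k n : ℤ) (l : ℕ) : ℝ := ∫ x, f x * walsh l ((2 : ℝ) ^ k * x - n)

theorem integrable_mul_walsh {f : ℝ → ℝ} (hf : Integrable f) (k n : ℤ) (l : ℕ) :
    Integrable fun x => f x * walsh l ((2 : ℝ) ^ k * x - n) := by
  have hm := measurable_walsh l
  refine hf.mul_bdd (c := 1) ?_ ?_
  · exact Measurable.aestronglyMeasurable (by fun_prop)
  · exact Filter.Eventually.of_forall fun x =>
      (abs_walsh_le l _).trans (walsh_zero_le_one _)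

theorem walshCoeff_two_mul {f : ℝ → ℝ} (hf : Integrable f) (k n : ℤ) (l : ℕ) :
    walshCoeff f k n (2 * l) =
      walshCoeff f (k + 1) (2 * n) l + walshCoeff f (k + 1) (2 * n + 1) l := by
  unfold walshCoeff
  rw [← integral_add (integrable_mul_walsh hf _ _ _) (integrable_mul_walsh hf _ _ _)]
  congr 1 with x
  rw [walsh_two_mul, zpow_add_one₀ two_ne_zero]
  push_cast
  ring_nf

theorem walshCoeff_two_mul_add_one {f : ℝ → ℝ} (hf : Integrable f) (k n : ℤ) (l : ℕ) :
    walshCoeff f k n (2 * l + 1) =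
      walshCoeff f (k + 1) (2 * n) l - walshCoeff f (k + 1) (2 * n + 1) l := by
  unfold walshCoeff
  rw [← integral_sub (integrable_mul_walsh hf _ _ _) (integrable_mul_walsh hf _ _ _)]
  congr 1 with x
  rw [walsh_two_mul_add_one, zpow_add_one₀ two_ne_zero]
  push_cast
  ring_nf

/-- The mass of `f` on the dyadic interval `[2^{-k}n, 2^{-k}(n+1))`. -/
def dyadicMass (f : ℝ → ℝ) (k n : ℤ) : ℝ := walshCoeff (fun x => |f x|) k n 0

theorem dyadicMass_split {f : ℝ → ℝ} (hf : Integrable f) (k n : ℤ) :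
    dyadicMass f k n = dyadicMass f (k + 1) (2 * n) + dyadicMass f (k + 1) (2 * n + 1) := by
  simpa [dyadicMass] using walshCoeff_two_mul hf.abs k n 0

theorem dyadicMass_nonneg (f : ℝ → ℝ) (k n : ℤ) : 0 ≤ dyadicMass f k n :=
  integral_nonneg fun _ => mul_nonneg (abs_nonneg _) (walsh_zero_nonneg _)

theorem abs_walshCoeff_le {f : ℝ → ℝ} (hf : Integrable f) (k n : ℤ) (l : ℕ) :
    |walshCoeff f k n l| ≤ dyadicMass f k n := by
  refine abs_integral_le_integral_abs.trans ?_
  refine integral_mono (integrable_mul_walsh hf _ _ _).abs (integrable_mul_walsh hf.abs _ _ _) ?_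
  intro x
  simp only [abs_mul]
  exact mul_le_mul_of_nonneg_left (abs_walsh_le _ _) (abs_nonneg _)

theorem winner_sq (f : ℝ → ℝ) (p : Tile) :
    winner f p ^ 2 = (2 : ℝ) ^ p.k * walshCoeff f p.k p.n p.l ^ 2 := by
  have h : winner f p = (2 : ℝ) ^ ((p.k : ℝ) / 2) * walshCoeff f p.k p.n p.l := by
    unfold winner walshCoeff Tile.wp
    rw [← integral_const_mul]
    congr 1 with x
    ring
  rw [h, mul_pow, ← Real.rpow_natCast, ← Real.rpow_mul two_pos.le, ← Real.rpow_intCast]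
  norm_num

/-- The concave profile of the Bellman function: `4μt - t²` for `t ≤ 2μ`, constant afterwards. -/
def bellmanProfile (μ t : ℝ) : ℝ := 4 * μ ^ 2 - max (2 * μ - t) 0 ^ 2

theorem bellmanProfile_le (μ t : ℝ) : bellmanProfile μ t ≤ 4 * μ ^ 2 := by
  unfold bellmanProfile; nlinarith [sq_nonneg (max (2 * μ - t) 0)]

theorem bellmanProfile_nonneg {μ t : ℝ} (hμ : 0 ≤ μ) (ht : 0 ≤ t) : 0 ≤ bellmanProfile μ t := by
  unfold bellmanProfile
  have h0 : 0 ≤ max (2 * μ - t) 0 := le_max_right _ _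
  have h1 : max (2 * μ - t) 0 ≤ 2 * μ := max_le (by linarith) (by linarith)
  nlinarith

theorem bellmanProfile_midpoint (μ p q : ℝ) :
    (bellmanProfile μ p + bellmanProfile μ q) / 2 ≤ bellmanProfile μ ((p + q) / 2) := by
  unfold bellmanProfile
  have hp := le_max_left (2 * μ - p) 0
  have hp0 := le_max_right (2 * μ - p) 0
  have hq := le_max_left (2 * μ - q) 0
  have hq0 := le_max_right (2 * μ - q) 0
  have h : max (2 * μ - (p + q) / 2) 0 ≤ (max (2 * μ - p) 0 + max (2 * μ - q) 0) / 2 :=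
    max_le (by linarith) (by linarith)
  have h0 := le_max_right (2 * μ - (p + q) / 2) 0
  nlinarith [sq_nonneg (max (2 * μ - p) 0 - max (2 * μ - q) 0), pow_le_pow_left₀ h0 h 2]

theorem bellmanProfile_midpoint_eq {μ p q : ℝ} (hp : 0 ≤ p) (hq : 0 ≤ q) (h : (p + q) / 2 ≤ μ) :
    bellmanProfile μ ((p + q) / 2) =
      (bellmanProfile μ p + bellmanProfile μ q) / 2 + ((p - q) / 2) ^ 2 := by
  unfold bellmanProfile
  rw [max_eq_left (by linarith), max_eq_left (by linarith), max_eq_left (by linarith)]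
  ring

/-- The Bellman function of the mean `M` of `|f|` and the mean `m` of a unimodular multiple
of `f`. -/
def bellman (μ M m : ℝ) : ℝ :=
  2 * (bellmanProfile μ ((M + m) / 2) + bellmanProfile μ ((M - m) / 2))

theorem bellman_neg (μ M m : ℝ) : bellman μ M (-m) = bellman μ M m := by
  unfold bellman
  rw [← sub_eq_add_neg, sub_neg_eq_add, add_comm (bellmanProfile _ _)]

theorem bellman_le (μ M m : ℝ) : bellman μ M m ≤ 16 * μ ^ 2 := by
  unfold bellman
  linarith [bellmanProfile_le μ ((M + m) / 2), bellmanProfile_le μ ((M - m) / 2)]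

theorem bellman_nonneg {μ M m : ℝ} (hμ : 0 ≤ μ) (h : |m| ≤ M) : 0 ≤ bellman μ M m := by
  obtain ⟨h1, h2⟩ := abs_le.1 h
  unfold bellman
  have := bellmanProfile_nonneg hμ (t := (M + m) / 2) (by linarith)
  have := bellmanProfile_nonneg hμ (t := (M - m) / 2) (by linarith)
  linarith

theorem bellman_midpoint {μ M₁ M₂ m₁ m₂ : ℝ} (h₁ : |m₁| ≤ M₁) (h₂ : |m₂| ≤ M₂) :
    (bellman μ M₁ m₁ + bellman μ M₂ m₂) / 2 +
      (if (M₁ + M₂) / 2 ≤ μ then ((m₁ - m₂) / 2) ^ 2 else 0) ≤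
      bellman μ ((M₁ + M₂) / 2) ((m₁ + m₂) / 2) := by
  obtain ⟨h11, h12⟩ := abs_le.1 h₁
  obtain ⟨h21, h22⟩ := abs_le.1 h₂
  have e1 : ((M₁ + M₂) / 2 + (m₁ + m₂) / 2) / 2 = ((M₁ + m₁) / 2 + (M₂ + m₂) / 2) / 2 := by ring
  have e2 : ((M₁ + M₂) / 2 - (m₁ + m₂) / 2) / 2 = ((M₁ - m₁) / 2 + (M₂ - m₂) / 2) / 2 := by ring
  unfold bellman
  rw [e1, e2]
  split_ifs with h
  · rw [bellmanProfile_midpoint_eq (p := (M₁ + m₁) / 2) (by linarith) (by linarith) (by linarith),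
      bellmanProfile_midpoint_eq (p := (M₁ - m₁) / 2) (by linarith) (by linarith) (by linarith)]
    nlinarith [sq_nonneg (((M₁ + m₁) / 2 - (M₂ + m₂) / 2) + ((M₁ - m₁) / 2 - (M₂ - m₂) / 2))]
  · linarith [bellmanProfile_midpoint μ ((M₁ + m₁) / 2) ((M₂ + m₂) / 2),
      bellmanProfile_midpoint μ ((M₁ - m₁) / 2) ((M₂ - m₂) / 2)]

/-- The other child of the frequency interval containing `l`. -/
def sibling (l : ℕ) : ℕ := if l % 2 = 0 then l + 1 else l - 1

/-- The Bellman function evaluated on the data of `f` at the tile `(k, n, l)`. -/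
def tileBellman (f : ℝ → ℝ) (μ : ℝ) (k n : ℤ) (l : ℕ) : ℝ :=
  (2 : ℝ) ^ (-k) * bellman μ ((2 : ℝ) ^ k * dyadicMass f k n) ((2 : ℝ) ^ k * walshCoeff f k n l)

theorem tileBellman_nonneg {f : ℝ → ℝ} (hf : Integrable f) {μ : ℝ} (hμ : 0 ≤ μ) (k n : ℤ)
    (l : ℕ) : 0 ≤ tileBellman f μ k n l := by
  refine mul_nonneg (by positivity) (bellman_nonneg hμ ?_)
  rw [abs_mul, abs_of_nonneg (by positivity : (0 : ℝ) ≤ 2 ^ k)]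
  exact mul_le_mul_of_nonneg_left (abs_walshCoeff_le hf k n l) (by positivity)

/-- The square of the `L²`-normalized coefficient at the sibling of the tile `(k, n, l)`, counted
only if the mean of `|f|` is at most `μ`. -/
def siblingEnergy (f : ℝ → ℝ) (μ : ℝ) (k n : ℤ) (l : ℕ) : ℝ :=
  if (2 : ℝ) ^ k * dyadicMass f k n ≤ μ then (2 : ℝ) ^ k * walshCoeff f k n (sibling l) ^ 2 else 0

theorem siblingEnergy_nonneg (f : ℝ → ℝ) (μ : ℝ) (k n : ℤ) (l : ℕ) :
    0 ≤ siblingEnergy f μ k n l := by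
  unfold siblingEnergy
  split_ifs <;> positivity

theorem tileBellman_step {f : ℝ → ℝ} (hf : Integrable f) (μ : ℝ) (k n : ℤ) (l : ℕ) :
    siblingEnergy f μ k n l + tileBellman f μ (k + 1) (2 * n) (l / 2) +
      tileBellman f μ (k + 1) (2 * n + 1) (l / 2) ≤ tileBellman f μ k n l := by
  unfold siblingEnergy tileBellman
  have hk : (0 : ℝ) < 2 ^ k := by positivity
  have hk1 : (2 : ℝ) ^ (k + 1) = 2 * 2 ^ k := by rw [zpow_add_one₀ two_ne_zero]; ring
  rw [zpow_neg, zpow_neg, hk1, dyadicMass_split hf k n]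
  have b1 := abs_walshCoeff_le hf (k + 1) (2 * n) (l / 2)
  have b2 := abs_walshCoeff_le hf (k + 1) (2 * n + 1) (l / 2)
  set A := (2 : ℝ) ^ k
  set V₁ := dyadicMass f (k + 1) (2 * n)
  set V₂ := dyadicMass f (k + 1) (2 * n + 1)
  have hA : (0 : ℝ) ≤ 2 * A := by positivity
  have key : ∀ u₂ u u' : ℝ, |u₂| ≤ V₂ → u = walshCoeff f (k + 1) (2 * n) (l / 2) + u₂ →
      u' = walshCoeff f (k + 1) (2 * n) (l / 2) - u₂ →
      (if A * (V₁ + V₂) ≤ μ then A * u' ^ 2 else 0) +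
        (2 * A)⁻¹ * bellman μ (2 * A * V₁)
          (2 * A * walshCoeff f (k + 1) (2 * n) (l / 2)) +
        (2 * A)⁻¹ * bellman μ (2 * A * V₂) (2 * A * u₂) ≤
      A⁻¹ * bellman μ (A * (V₁ + V₂)) (A * u) := by
    intro u₂ u u' h hu hu'
    have h := bellman_midpoint (μ := μ) (M₁ := 2 * A * V₁) (M₂ := 2 * A * V₂)
      (m₁ := 2 * A * walshCoeff f (k + 1) (2 * n) (l / 2)) (m₂ := 2 * A * u₂)
      (by rw [abs_mul, abs_of_nonneg hA]; exact mul_le_mul_of_nonneg_left b1 hA)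
      (by rw [abs_mul, abs_of_nonneg hA]; exact mul_le_mul_of_nonneg_left h hA)
    have e1 : (2 * A * V₁ + 2 * A * V₂) / 2 = A * (V₁ + V₂) := by ring
    have e2 : (2 * A * walshCoeff f (k + 1) (2 * n) (l / 2) + 2 * A * u₂) / 2 = A * u := by
      rw [hu]; ring
    have e3 : (2 * A * walshCoeff f (k + 1) (2 * n) (l / 2) - 2 * A * u₂) / 2 = A * u' := by
      rw [hu']; ring
    rw [e1, e2, e3] at h
    refine le_trans (le_of_eq ?_) (mul_le_mul_of_nonneg_left h (inv_pos.2 hk).le)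
    split_ifs <;> field_simp <;> ring
  rcases Nat.even_or_odd' l with ⟨c, rfl | rfl⟩
  · have hc : 2 * c / 2 = c := by omega
    have hs : sibling (2 * c) = 2 * c + 1 := by simp [sibling]
    rw [hc] at b1 b2 key ⊢
    rw [hs]
    exact key _ _ _ b2 (walshCoeff_two_mul hf k n c) (walshCoeff_two_mul_add_one hf k n c)
  · have hc : (2 * c + 1) / 2 = c := by omega
    have hs : sibling (2 * c + 1) = 2 * c := by simp [sibling, Nat.add_mod]
    rw [hc] at b1 b2 key ⊢
    rw [hs]
    have := key (-walshCoeff f (k + 1) (2 * n + 1) c) _ _ (by rwa [abs_neg])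
      ((walshCoeff_two_mul_add_one hf k n c).trans (sub_eq_add_neg _ _))
      ((walshCoeff_two_mul hf k n c).trans (sub_neg_eq_add _ _).symm)
    rwa [mul_neg, bellman_neg] at this

/-- The order on tiles in terms of the integer parameters. -/
def Tile.Below (p : Tile) (k n : ℤ) (l : ℕ) : Prop :=
  ∃ d : ℕ, p.k = k + d ∧ p.n / 2 ^ d = n ∧ p.l = l / 2 ^ d

theorem Tile.le.below {p t : Tile} (h : p.le t) : p.Below t.k t.n t.l := by
  rcases h with ⟨hs, hw⟩ | rfl
  swap
  · exact ⟨0, by simp⟩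
  have hs := hs.subset
  unfold Tile.spat at hs
  unfold Tile.freq at hw
  have pos : ∀ a : ℤ, (0 : ℝ) < 2 ^ a := fun a => by positivity
  rw [Ico_subset_Ico_iff (mul_lt_mul_of_pos_left (lt_add_one _) (pos _))] at hs
  rw [Ico_subset_Ico_iff (mul_lt_mul_of_pos_left (lt_add_one _) (pos _))] at hw
  obtain ⟨hs1, hs2⟩ := hs
  obtain ⟨hw1, hw2⟩ := hw
  have hk : t.k ≤ p.k := by
    have : (2 : ℝ) ^ t.k ≤ 2 ^ p.k := by linarith
    exact (zpow_le_zpow_iff_right₀ one_lt_two).1 this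
  obtain ⟨d, hd⟩ := Int.le.dest hk
  have hpk : (2 : ℝ) ^ p.k = 2 ^ t.k * 2 ^ d := by
    rw [← hd, zpow_add₀ two_ne_zero, zpow_natCast]
  have ht := pos t.k
  have h2d : (0 : ℝ) < 2 ^ d := by positivity
  refine ⟨d, hd.symm, ?_, ?_⟩
  · rw [zpow_neg, zpow_neg, hpk] at hs1 hs2
    field_simp at hs1 hs2
    have i1 : t.n * 2 ^ d ≤ p.n := by exact_mod_cast hs1
    have i2 : p.n + 1 ≤ 2 ^ d * (t.n + 1) := by exact_mod_cast hs2
    have hp : (0 : ℤ) < 2 ^ d := by positivity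
    refine le_antisymm (Int.lt_add_one_iff.1 ((Int.ediv_lt_iff_lt_mul hp).2 ?_))
      ((Int.le_ediv_iff_mul_le hp).2 ?_) <;> linarith
  · rw [hpk, mul_assoc] at hw1 hw2
    have i1 : 2 ^ d * p.l ≤ t.l := by exact_mod_cast le_of_mul_le_mul_left hw1 ht
    have i2 : t.l + 1 ≤ 2 ^ d * (p.l + 1) := by exact_mod_cast le_of_mul_le_mul_left hw2 ht
    have hp : 0 < 2 ^ d := by positivity
    refine le_antisymm ((Nat.le_div_iff_mul_le hp).2 ?_)
      (Nat.lt_add_one_iff.1 ((Nat.div_lt_iff_lt_mul hp).2 ?_)) <;> linarith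

theorem Tile.Below.eq_or_child {p : Tile} {k n : ℤ} {l : ℕ} (h : p.Below k n l) :
    p = ⟨k, n, l⟩ ∨ p.Below (k + 1) (2 * n) (l / 2) ∨ p.Below (k + 1) (2 * n + 1) (l / 2) := by
  obtain ⟨d, hk, hn, hl⟩ := h
  rcases d with _ | d
  · left
    obtain ⟨pk, pn, pl⟩ := p
    simp_all
  · right
    have hk' : p.k = k + 1 + d := by rw [hk]; push_cast; ring
    have hl' : p.l = l / 2 / 2 ^ d := by rw [hl, Nat.div_div_eq_div_mul, pow_succ']
    have hn' : p.n / 2 ^ d / 2 = n := by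
      rw [Int.ediv_ediv_of_nonneg (by positivity), ← pow_succ, hn]
    rcases Int.emod_two_eq_zero_or_one (p.n / 2 ^ d) with h | h
    · exact Or.inl ⟨d, hk', by omega, hl'⟩
    · exact Or.inr ⟨d, hk', by omega, hl'⟩

theorem Tile.Below.le_k {p : Tile} {k n : ℤ} {l : ℕ} (h : p.Below k n l) : k ≤ p.k := by
  obtain ⟨d, hk, -⟩ := h
  omega

theorem walshCoeff_sq_le {f : ℝ → ℝ} (hf : Integrable f) (k n : ℤ) (l : ℕ) :
    (2 : ℝ) ^ k * walshCoeff f k n l ^ 2 ≤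
      (2 : ℝ) ^ (k + 1) * walshCoeff f (k + 1) (2 * n) (l / 2) ^ 2 +
      (2 : ℝ) ^ (k + 1) * walshCoeff f (k + 1) (2 * n + 1) (l / 2) ^ 2 := by
  have hk : (0 : ℝ) < 2 ^ k := by positivity
  rw [zpow_add_one₀ two_ne_zero]
  rcases Nat.even_or_odd' l with ⟨c, rfl | rfl⟩
  · rw [walshCoeff_two_mul hf, Nat.mul_div_cancel_left _ two_pos]
    nlinarith [mul_nonneg hk.le (sq_nonneg (walshCoeff f (k + 1) (2 * n) c -
      walshCoeff f (k + 1) (2 * n + 1) c))]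
  · have hc : (2 * c + 1) / 2 = c := by omega
    rw [walshCoeff_two_mul_add_one hf, hc]
    nlinarith [mul_nonneg hk.le (sq_nonneg (walshCoeff f (k + 1) (2 * n) c +
      walshCoeff f (k + 1) (2 * n + 1) c))]

theorem winner_sq_le {f : ℝ → ℝ} (hf : Integrable f) {lam : ℝ} (hlam : 0 ≤ lam) {i j : ℕ}
    (hi : i ∈ ({1, 2, 3} : Set ℕ)) (hj : j ∈ ({1, 2, 3} : Set ℕ)) (hij : i ≠ j) (P : Quartile)
    (hP : (2 : ℝ) ^ P.k * dyadicMass f P.k P.n ≤ lam) :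
    winner f (P.st j) ^ 2 ≤ siblingEnergy f (2 * lam) P.k P.n (P.st i).l +
      siblingEnergy f (2 * lam) (P.k + 1) (2 * P.n) ((P.st i).l / 2) +
      siblingEnergy f (2 * lam) (P.k + 1) (2 * P.n + 1) ((P.st i).l / 2) := by
  by_cases hs : (P.st j).l = sibling (P.st i).l
  · have h0 : winner f (P.st j) ^ 2 = siblingEnergy f (2 * lam) P.k P.n (P.st i).l := by
      rw [winner_sq, siblingEnergy, if_pos (by linarith), hs]
      rfl
    rw [h0]
    linarith [siblingEnergy_nonneg f (2 * lam) (P.k + 1) (2 * P.n) ((P.st i).l / 2),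
      siblingEnergy_nonneg f (2 * lam) (P.k + 1) (2 * P.n + 1) ((P.st i).l / 2)]
  · have hs' : (P.st j).l / 2 = sibling ((P.st i).l / 2) := by
      simp only [mem_insert_iff, mem_singleton_iff] at hi hj
      unfold sibling Quartile.st at *
      simp only at *
      split_ifs at * <;> omega
    have hsplit := dyadicMass_split hf P.k P.n
    have n1 := dyadicMass_nonneg f (P.k + 1) (2 * P.n)
    have n2 := dyadicMass_nonneg f (P.k + 1) (2 * P.n + 1)
    have hk : (0 : ℝ) < 2 ^ P.k := by positivity
    have hk1 : (2 : ℝ) ^ (P.k + 1) = 2 * 2 ^ P.k := by rw [zpow_add_one₀ two_ne_zero]; ring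
    rw [hsplit] at hP
    have a1 : (2 : ℝ) ^ (P.k + 1) * dyadicMass f (P.k + 1) (2 * P.n) ≤ 2 * lam := by
      rw [hk1]; nlinarith
    have a2 : (2 : ℝ) ^ (P.k + 1) * dyadicMass f (P.k + 1) (2 * P.n + 1) ≤ 2 * lam := by
      rw [hk1]; nlinarith
    have h0 := siblingEnergy_nonneg f (2 * lam) P.k P.n (P.st i).l
    have h1 := walshCoeff_sq_le hf P.k P.n (P.st j).l
    rw [winner_sq]
    have c1 : siblingEnergy f (2 * lam) (P.k + 1) (2 * P.n) ((P.st i).l / 2) = _ := if_pos a1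
    have c2 : siblingEnergy f (2 * lam) (P.k + 1) (2 * P.n + 1) ((P.st i).l / 2) = _ := if_pos a2
    rw [c1, c2, ← hs']
    exact h1.trans (by linarith)

theorem Quartile.st_injective (i : ℕ) : Function.Injective fun P : Quartile => P.st i := by
  rintro ⟨k, n, l⟩ ⟨k', n', l'⟩ h
  simp only [Quartile.st, Tile.mk.injEq] at h
  obtain ⟨h1, h2, h3⟩ := h
  simp only [Quartile.mk.injEq]
  exact ⟨h1, h2, by omega⟩

theorem sum_winner_sq_le {f : ℝ → ℝ} (hf : Integrable f) {lam : ℝ} (hlam : 0 ≤ lam) {i j : ℕ}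
    (hi : i ∈ ({1, 2, 3} : Set ℕ)) (hj : j ∈ ({1, 2, 3} : Set ℕ)) (hij : i ≠ j) (N : ℕ) :
    ∀ (k n : ℤ) (l : ℕ) (T : Finset Quartile),
      (∀ P ∈ T, (P.st i).Below k n l ∧ P.k < k + N ∧
        (2 : ℝ) ^ P.k * dyadicMass f P.k P.n ≤ lam) →
      (∑ P ∈ T, winner f (P.st j) ^ 2) + siblingEnergy f (2 * lam) k n l ≤
        2 * tileBellman f (2 * lam) k n l := by
  have hμ : 0 ≤ 2 * lam := by positivity
  induction N with
  | zero =>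
    intro k n l T hT
    have hT0 : T = ∅ := Finset.eq_empty_of_forall_notMem fun P hP => by
      obtain ⟨h1, h2, -⟩ := hT P hP
      have h3 : k ≤ P.k := h1.le_k
      simp only [Nat.cast_zero, add_zero] at h2
      omega
    rw [hT0, Finset.sum_empty, zero_add]
    linarith [tileBellman_step hf (2 * lam) k n l, tileBellman_nonneg hf hμ k n l,
      tileBellman_nonneg hf hμ (k + 1) (2 * n) (l / 2),
      tileBellman_nonneg hf hμ (k + 1) (2 * n + 1) (l / 2)]
  | succ N ih =>
    intro k n l T hT
    set T₁ := T.filter fun P => (P.st i).Below (k + 1) (2 * n) (l / 2) with hT₁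
    set T₂ := T.filter fun P => (P.st i).Below (k + 1) (2 * n + 1) (l / 2) with hT₂
    set T₀ := T.filter fun P => P.st i = ⟨k, n, l⟩ with hT₀
    have s1 := ih (k + 1) (2 * n) (l / 2) T₁ fun P hP => by
      obtain ⟨hP, hb⟩ := Finset.mem_filter.1 hP
      obtain ⟨-, h2, h3⟩ := hT P hP
      exact ⟨hb, by push_cast at h2; omega, h3⟩
    have s2 := ih (k + 1) (2 * n + 1) (l / 2) T₂ fun P hP => by
      obtain ⟨hP, hb⟩ := Finset.mem_filter.1 hP
      obtain ⟨-, h2, h3⟩ := hT P hP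
      exact ⟨hb, by push_cast at h2; omega, h3⟩
    have hsum : ∑ P ∈ T, winner f (P.st j) ^ 2 ≤ ∑ P ∈ T₀, winner f (P.st j) ^ 2 +
        ∑ P ∈ T₁, winner f (P.st j) ^ 2 + ∑ P ∈ T₂, winner f (P.st j) ^ 2 := by
      rw [hT₀, hT₁, hT₂, Finset.sum_filter, Finset.sum_filter, Finset.sum_filter,
        ← Finset.sum_add_distrib, ← Finset.sum_add_distrib]
      refine Finset.sum_le_sum fun P hP => ?_
      have hsq := sq_nonneg (winner f (P.st j))
      rcases (hT P hP).1.eq_or_child with h | h | h <;> rw [if_pos h] <;> split_ifs <;> linarith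
    have hstep := tileBellman_step hf (2 * lam) k n l
    have hnn := siblingEnergy_nonneg f (2 * lam) k n l
    have hnn1 := siblingEnergy_nonneg f (2 * lam) (k + 1) (2 * n) (l / 2)
    have hnn2 := siblingEnergy_nonneg f (2 * lam) (k + 1) (2 * n + 1) (l / 2)
    have hzero : ∑ P ∈ T₀, winner f (P.st j) ^ 2 ≤ siblingEnergy f (2 * lam) k n l +
        siblingEnergy f (2 * lam) (k + 1) (2 * n) (l / 2) +
        siblingEnergy f (2 * lam) (k + 1) (2 * n + 1) (l / 2) := by
      rcases T₀.eq_empty_or_nonempty with h | ⟨P, hP⟩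
      · rw [h, Finset.sum_empty]; positivity
      · have hsing : T₀ = {P} := by
          refine Finset.eq_singleton_iff_unique_mem.2 ⟨hP, fun Q hQ => ?_⟩
          exact Quartile.st_injective i
            ((Finset.mem_filter.1 hQ).2.trans (Finset.mem_filter.1 hP).2.symm)
        obtain ⟨hPT, hPe⟩ := Finset.mem_filter.1 hP
        have h := winner_sq_le hf hlam hi hj hij P (hT P hPT).2.2
        have ek : P.k = k := congrArg Tile.k hPe
        have en : P.n = n := congrArg Tile.n hPe
        rw [hPe, ek, en] at h
        rw [hsing, Finset.sum_singleton]
        exact h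
    linarith

theorem dyadicMass_le {E : Set ℝ} (hE : MeasurableSet E) (hfin : volume E < ∞) {f : ℝ → ℝ}
    (hsupp : ∀ x, x ∉ E → f x = 0) (hbd : ∀ x, |f x| ≤ 1) (hf : Integrable f) (P : Quartile) :
    dyadicMass f P.k P.n ≤ (volume (E ∩ P.spat)).toReal := by
  have hm : MeasurableSet (E ∩ P.spat) := hE.inter measurableSet_Ico
  have hlt : volume (E ∩ P.spat) < ∞ := (measure_mono inter_subset_left).trans_lt hfin
  have h1 : (volume (E ∩ P.spat)).toReal = ∫ x, (E ∩ P.spat).indicator (1 : ℝ → ℝ) x := by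
    rw [integral_indicator_one hm]; rfl
  rw [h1]
  refine integral_mono (integrable_mul_walsh hf.abs _ _ _) ?_ fun x => ?_
  · exact (integrable_indicator_iff hm).2 (integrableOn_const hlt.ne)
  · have hk : (0 : ℝ) < 2 ^ P.k := by positivity
    by_cases hx : x ∈ E ∩ P.spat
    · rw [indicator_of_mem hx]
      exact mul_le_one₀ (hbd x) (walsh_zero_nonneg _) (walsh_zero_le_one _)
    · rw [indicator_of_notMem hx]
      by_cases hxE : x ∈ E
      · have hxs : x ∉ P.spat := fun h => hx ⟨hxE, h⟩
        have : ¬ (0 ≤ (2 : ℝ) ^ P.k * x - P.n ∧ (2 : ℝ) ^ P.k * x - P.n < 1) := by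
          rintro ⟨h1, h2⟩
          refine hxs ⟨?_, ?_⟩
          · rw [zpow_neg, inv_mul_le_iff₀ hk]; linarith
          · rw [zpow_neg, lt_inv_mul_iff₀ hk]; linarith
        simp only [walsh, if_neg this, mul_zero, le_refl]
      · simp [hsupp x hxE]


/-- Size estimate: `size_j((⟨f, φ_{P_j}⟩)_{P∈𝐏}) ≲ sup_{P∈𝐏} |E ∩ I_P|/|I_P|`. -/
theorem size_le :
    ∃ C : ℝ, 0 < C ∧ ∀ (j : ℕ), j ∈ ({1,2,3} : Set ℕ) →
      ∀ (E : Set ℝ), MeasurableSet E → volume E < ∞ →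
      ∀ f : ℝ → ℝ, (Measurable f ∧ (∀ x, x ∉ E → f x = 0) ∧ ∀ x, |f x| ≤ 1) →
      ∀ PP : Finset Quartile,
        size PP j (fun P => winner f (P.st j)) ≤
          C * sSup {r | ∃ P ∈ PP, r = (volume (E ∩ P.spat)).toReal / P.len} := by
  refine ⟨12, by norm_num, ?_⟩
  rintro j hj E hE hfin f ⟨hmeas, hsupp, hbd⟩ PP
  set S : Set ℝ := {r | ∃ P ∈ PP, r = (volume (E ∩ P.spat)).toReal / P.len}
  have len_pos : ∀ P : Quartile, 0 < P.len := fun P => by unfold Quartile.len; positivity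
  have hS0 : 0 ≤ sSup S := Real.sSup_nonneg fun r ⟨P, _, hr⟩ => by
    rw [hr]; exact div_nonneg ENNReal.toReal_nonneg (len_pos P).le
  have hSb : BddAbove S := by
    refine ((PP.finite_toSet.image
      fun P => (volume (E ∩ P.spat)).toReal / P.len).subset ?_).bddAbove
    rintro r ⟨P, hP, rfl⟩
    exact ⟨P, hP, rfl⟩
  have hf : Integrable f := by
    have h1 : IntegrableOn f E :=
      IntegrableOn.of_bound hfin hmeas.aestronglyMeasurable 1
        (Filter.Eventually.of_forall fun x => hbd x)
    exact (integrableOn_iff_integrable_of_support_subset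
      fun x hx => by_contra fun h => hx (hsupp x h)).1 h1
  refine Real.sSup_le ?_ (by positivity)
  rintro s ⟨i, hi, hij, Ptop, T, hTPP, htree, rfl⟩
  refine Real.sqrt_le_iff.2 ⟨by positivity, ?_⟩
  rw [inv_mul_le_iff₀ (len_pos Ptop)]
  simp only [sq_abs]
  have hmass : ∀ P ∈ T, (2 : ℝ) ^ P.k * dyadicMass f P.k P.n ≤ sSup S := fun P hP => by
    refine le_trans ?_ (le_csSup hSb ⟨P, hTPP hP, rfl⟩)
    rw [Quartile.len, zpow_neg, div_inv_eq_mul, mul_comm]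
    exact mul_le_mul_of_nonneg_right (dyadicMass_le hE hfin hsupp hbd hf P) (by positivity)
  obtain ⟨N, hN⟩ : ∃ N : ℕ, ∀ P ∈ T, P.k < Ptop.k + N := by
    refine ⟨∑ P ∈ T, ((P.k - Ptop.k).toNat + 1), fun P hP => ?_⟩
    have h := Finset.single_le_sum (f := fun P : Quartile => (P.k - Ptop.k).toNat + 1)
      (fun _ _ => Nat.zero_le _) hP
    omega
  have main := sum_winner_sq_le hf hS0 hi hj hij N Ptop.k Ptop.n (Ptop.st i).l T
    fun P hP => ⟨(htree P hP).below, hN P hP, hmass P hP⟩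
  have hB : tileBellman f (2 * sSup S) Ptop.k Ptop.n (Ptop.st i).l ≤
      Ptop.len * (16 * (2 * sSup S) ^ 2) :=
    mul_le_mul_of_nonneg_left (bellman_le _ _ _) (len_pos Ptop).le
  have hnn := siblingEnergy_nonneg f (2 * sSup S) Ptop.k Ptop.n (Ptop.st i).l
  nlinarith [mul_nonneg (len_pos Ptop).le (sq_nonneg (sSup S))]

end
end
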